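/- Let X be a Banach space, δ > 0 and α < ω₁. If the closed unit ball B_X contains a δ-α-tree (x_s)_{s∈T_α}, then its root x_∅ belongs to d_δ^α(B_X); in particular D(X,δ) > α and D(X) > α. -/

import Mathlib

open Metric Set Topology

noncomputable section

/-- Transfinite iteration of a derivation `d` starting from `a`;
meets are taken at limit stages. -/
def derivIter {L : Type*} [CompleteLattice L] (d : L → L) (a : L) (α : Ordinal) : L :=
  Ordinal.limitRecOn α a (fun _ ih => d ih) (fun o _ ih => ⨅ (γ : Ordinal) (h : γ < o), ih γ h)

/-- The weak topology of a real normed space. -/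
def weakTop (X : Type*) [NormedAddCommGroup X] [NormedSpace ℝ X] : TopologicalSpace X :=
  TopologicalSpace.induced (fun (x : X) (f : X →L[ℝ] ℝ) => f x) inferInstance

variable {X : Type*} [NormedAddCommGroup X] [NormedSpace ℝ X]

/-- The dentability derivation `d_ε^1`. -/
def dentDeriv (ε : ℝ) (C : Set X) : Set X :=
  C \ ⋃ (f : X →L[ℝ] ℝ) (a : ℝ) (_ : Metric.diam ({y | a < f y} ∩ C) < ε), {y | a < f y}

/-- The weak fragmentation derivation `σ_ε^1`. -/
def weakDeriv (ε : ℝ) (C : Set X) : Set X :=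
  C \ ⋃ (V : Set X) (_ : IsOpen[weakTop X] V) (_ : Metric.diam (V ∩ C) < ε), V

/-- The convex weak fragmentation derivation `γ_ε^1`. -/
def convDeriv (ε : ℝ) (C : Set X) : Set X :=
  closure (convexHull ℝ (weakDeriv ε C))

/-- `treeRoot C δ α x` : `x` is the root of a `δ`-`α`-tree contained in `C`. -/
def treeRoot (C : Set X) (δ : ℝ) (α : Ordinal) : X → Prop :=
  Ordinal.limitRecOn α (fun x => x ∈ C)
    (fun _ ih x => x ∈ C ∧ ∃ y z : X,
      x = (2⁻¹ : ℝ) • (y + z) ∧ δ ≤ 2⁻¹ * ‖y - z‖ ∧ ih y ∧ ih z)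
    (fun o _ ih x => ∀ γ (h : γ < o), ih γ h x)

/-- `sprawlRoot C δ α x` : `x` is the root of a `δ`-`α`-sprawling tree contained in `C`. -/
def sprawlRoot (C : Set X) (δ : ℝ) (α : Ordinal) : X → Prop :=
  Ordinal.limitRecOn α (fun x => x ∈ C)
    (fun _ ih x => x ∈ C ∧ ∃ y z : ℕ → X,
      (∀ n, x = (2⁻¹ : ℝ) • (y n + z n)) ∧
      (∀ n m, n ≠ m → δ ≤ ‖y n - y m‖) ∧
      (∀ n, ih (y n)) ∧ (∀ n, ih (z n)))
    (fun o _ ih x => ∀ γ (h : γ < o), ih γ h x)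

/-- `bushRoot C δ α x` : `x` is the root of a `δ`-`α`-bush contained in `C`. -/
def bushRoot (C : Set X) (δ : ℝ) (α : Ordinal) : X → Prop :=
  Ordinal.limitRecOn α (fun x => x ∈ C)
    (fun _ ih x => x ∈ C ∧ ∃ (n : ℕ) (y : Fin (n + 1) → X) (lam : Fin (n + 1) → ℝ),
      (∀ i, 0 < lam i ∧ lam i ≤ 1) ∧ (∑ i, lam i = 1) ∧
      x = ∑ i, lam i • y i ∧ (∀ i, δ ≤ ‖x - y i‖) ∧ ∀ i, ih (y i))
    (fun o _ ih x => ∀ γ (h : γ < o), ih γ h x)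

/-- `X` has the Slice Point of Continuity Property. -/
def SlicePCP (X : Type*) [NormedAddCommGroup X] [NormedSpace ℝ X] : Prop :=
  ∀ A : Set X, A.Nonempty → Bornology.IsBounded A → ∀ ε > (0 : ℝ),
    ∃ (f : X →L[ℝ] ℝ) (a : ℝ), ({y | a < f y} ∩ A).Nonempty ∧
      ∀ x ∈ {y | a < f y} ∩ A, ∃ V ∈ @nhds X (weakTop X) x, Metric.diam (V ∩ A) < ε

theorem derivIter_zero {L : Type*} [CompleteLattice L] (d : L → L) (a : L) :
    derivIter d a 0 = a :=
  Ordinal.limitRecOn_zero ..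

theorem derivIter_add_one {L : Type*} [CompleteLattice L] (d : L → L) (a : L) (α : Ordinal) :
    derivIter d a (α + 1) = d (derivIter d a α) :=
  Ordinal.limitRecOn_add_one ..

theorem derivIter_limit {L : Type*} [CompleteLattice L] (d : L → L) (a : L) {o : Ordinal}
    (ho : Order.IsSuccLimit o) :
    derivIter d a o = ⨅ (γ : Ordinal) (_ : γ < o), derivIter d a γ :=
  Ordinal.limitRecOn_limit _ _ _ _ ho

theorem treeRoot_zero (C : Set X) (δ : ℝ) (x : X) : treeRoot C δ 0 x ↔ x ∈ C := by
  unfold treeRoot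
  rw [Ordinal.limitRecOn_zero]

theorem treeRoot_add_one (C : Set X) (δ : ℝ) (α : Ordinal) (x : X) :
    treeRoot C δ (α + 1) x ↔ x ∈ C ∧ ∃ y z : X,
      x = (2⁻¹ : ℝ) • (y + z) ∧ δ ≤ 2⁻¹ * ‖y - z‖ ∧ treeRoot C δ α y ∧ treeRoot C δ α z := by
  unfold treeRoot
  rw [Ordinal.limitRecOn_add_one]

theorem treeRoot_limit (C : Set X) (δ : ℝ) {o : Ordinal} (ho : Order.IsSuccLimit o) (x : X) :
    treeRoot C δ o x ↔ ∀ γ < o, treeRoot C δ γ x := by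
  unfold treeRoot
  rw [Ordinal.limitRecOn_limit _ _ _ _ ho]

theorem mem_dentDeriv {ε : ℝ} {C : Set X} {x : X} :
    x ∈ dentDeriv ε C ↔ x ∈ C ∧ ∀ (f : X →L[ℝ] ℝ) (a : ℝ), a < f x →
      ε ≤ Metric.diam ({y | a < f y} ∩ C) := by
  simp only [dentDeriv, mem_sdiff, mem_iUnion, mem_ofPred_eq, not_exists]
  refine and_congr_right fun _ => forall₂_congr fun f a => ?_
  rw [← not_lt]
  tauto

theorem convex_dentDeriv {ε : ℝ} {C : Set X} (hC : Convex ℝ C) : Convex ℝ (dentDeriv ε C) := by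
  intro y hy z hz s t hs ht hst
  rw [mem_dentDeriv] at hy hz ⊢
  refine ⟨hC hy.1 hz.1 hs ht hst, fun f a hfa => ?_⟩
  by_contra h
  have hfy : f y ≤ a := not_lt.1 fun h' => h (hy.2 f a h')
  have hfz : f z ≤ a := not_lt.1 fun h' => h (hz.2 f a h')
  exact hfa.not_ge ((convex_halfSpace_le f.isLinear a) hfy hfz hs ht hst)

theorem derivIter_dentDeriv_subset (ε : ℝ) (C : Set X) (α : Ordinal) :
    derivIter (dentDeriv ε) C α ⊆ C := by
  induction α using Ordinal.limitRecOn with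
  | zero => rw [derivIter_zero]
  | add_one α ih => rw [derivIter_add_one]; exact sdiff_subset.trans ih
  | limit o ho ih =>
    rw [derivIter_limit _ _ ho]
    exact (iInf₂_le 0 ho.bot_lt).trans (ih 0 ho.bot_lt)

theorem convex_derivIter_dentDeriv (ε : ℝ) {C : Set X} (hC : Convex ℝ C) (α : Ordinal) :
    Convex ℝ (derivIter (dentDeriv ε) C α) := by
  induction α using Ordinal.limitRecOn with
  | zero => rwa [derivIter_zero]
  | add_one α ih => rw [derivIter_add_one]; exact convex_dentDeriv ih
  | limit o ho ih =>
    rw [derivIter_limit _ _ ho]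
    exact convex_iInter₂ ih

/-- A slice through the midpoint of a segment contains one of its endpoints, so the midpoint
survives the dentability derivation whenever the half-length is at least `ε`. -/
theorem midpoint_mem_dentDeriv {ε : ℝ} {C : Set X} (hC : Convex ℝ C)
    (hb : Bornology.IsBounded C) {y z : X} (hy : y ∈ C) (hz : z ∈ C)
    (hyz : ε ≤ 2⁻¹ * ‖y - z‖) : (2⁻¹ : ℝ) • (y + z) ∈ dentDeriv ε C := by
  have hx : (2⁻¹ : ℝ) • (y + z) ∈ C := by
    rw [smul_add]
    exact hC hy hz (by norm_num) (by norm_num) (by norm_num)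
  refine mem_dentDeriv.2 ⟨hx, fun f a hfa => ?_⟩
  have hdiam {w : X} (hw : w ∈ C) (hfw : a < f w)
      (hdist : dist w ((2⁻¹ : ℝ) • (y + z)) = 2⁻¹ * ‖y - z‖) :
      ε ≤ Metric.diam ({y | a < f y} ∩ C) :=
    (hyz.trans_eq hdist.symm).trans
      (dist_le_diam_of_mem (hb.subset inter_subset_right) ⟨hfw, hw⟩ ⟨hfa, hx⟩)
  have hsum : a < 2⁻¹ * (f y + f z) := by simpa [mul_add] using hfa
  rcases lt_or_ge a (f y) with h | h
  · refine hdiam hy h ?_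
    rw [dist_eq_norm, show y - (2⁻¹ : ℝ) • (y + z) = (2⁻¹ : ℝ) • (y - z) by module, norm_smul]
    norm_num
  · refine hdiam hz (by linarith) ?_
    rw [dist_eq_norm, show z - (2⁻¹ : ℝ) • (y + z) = (2⁻¹ : ℝ) • (z - y) by module, norm_smul,
      norm_sub_rev]
    norm_num

theorem treeRoot.mem_derivIter {C : Set X} (hC : Convex ℝ C) (hb : Bornology.IsBounded C)
    {δ : ℝ} {α : Ordinal} {x : X} (hx : treeRoot C δ α x) :
    x ∈ derivIter (dentDeriv δ) C α := by
  induction α using Ordinal.limitRecOn generalizing x with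
  | zero => rwa [derivIter_zero, ← treeRoot_zero C δ]
  | add_one α ih =>
    obtain ⟨-, y, z, rfl, hyz, hy, hz⟩ := (treeRoot_add_one C δ α x).1 hx
    rw [derivIter_add_one]
    exact midpoint_mem_dentDeriv (convex_derivIter_dentDeriv δ hC α)
      (hb.subset (derivIter_dentDeriv_subset δ C α)) (ih hy) (ih hz) hyz
  | limit o ho ih =>
    rw [derivIter_limit _ _ ho]
    exact mem_iInter₂.2 fun γ hγ => ih γ hγ ((treeRoot_limit C δ ho x).1 hx γ hγ)

/-- If `B_X` contains a `δ`-`α`-tree, then its root belongs to `d_δ^α(B_X)`;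
in particular `d_δ^α(B_X) ≠ ∅`, i.e. `D(X, δ) > α` and `D(X) > α`. -/
theorem statement5 {X : Type*} [NormedAddCommGroup X] [NormedSpace ℝ X] [CompleteSpace X]
    (δ : ℝ) (hδ : 0 < δ) (α : Ordinal) (hα : α < (Cardinal.aleph 1).ord)
    (x : X) (hx : treeRoot (Metric.closedBall (0 : X) 1) δ α x) :
    x ∈ derivIter (dentDeriv δ) (Metric.closedBall (0 : X) 1) α ∧
      (derivIter (dentDeriv δ) (Metric.closedBall (0 : X) 1) α).Nonempty := by
  have hmem := hx.mem_derivIter (convex_closedBall 0 1) isBounded_closedBall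
  exact ⟨hmem, x, hmem⟩
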